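/- Let n < m (n ≥ 2), K_1 ⊆ ℝ^n and K_2 ⊆ ℝ^m proper cones with K_2 simplicial, X ∈ M_m, Y ∈ M_n, and L(A) = XAY. Then L maps the set of (K_1,K_2)-minimally semipositive matrices into itself if and only if X(K_2) = K_2 and Y is K_1-inverse nonnegative, or (−X)(K_2) = K_2 and −Y is K_1-inverse nonnegative. -/

import Mathlib

open Matrix Set

/-- The nonnegative orthant in `ℝ^n`. -/
def posOrth (n : ℕ) : Set (Fin n → ℝ) := {x | ∀ i, 0 ≤ x i}

/-- A proper cone: closed, pointed convex cone with nonempty interior. -/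
def IsProperCone {n : ℕ} (K : Set (Fin n → ℝ)) : Prop :=
  (∀ x ∈ K, ∀ y ∈ K, x + y ∈ K) ∧
  (∀ (c : ℝ), 0 ≤ c → ∀ x ∈ K, c • x ∈ K) ∧
  IsClosed K ∧ K ∩ (-K) = {0} ∧ (interior K).Nonempty

/-- The dual cone of a set in `ℝ^n`. -/
def dualCone {n : ℕ} (K : Set (Fin n → ℝ)) : Set (Fin n → ℝ) :=
  {y | ∀ x ∈ K, 0 ≤ y ⬝ᵥ x}

/-- `(K₁,K₂)`-semipositivity of a matrix. -/
def SemiposCone {n m : ℕ} (K₁ : Set (Fin n → ℝ)) (K₂ : Set (Fin m → ℝ))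
    (A : Matrix (Fin m) (Fin n) ℝ) : Prop :=
  ∃ x ∈ interior K₁, A.mulVec x ∈ interior K₂

/-- Semipositivity with respect to the nonnegative orthants. -/
def Semipos {n m : ℕ} (A : Matrix (Fin m) (Fin n) ℝ) : Prop :=
  ∃ x : Fin n → ℝ, (∀ i, 0 < x i) ∧ ∀ j, 0 < A.mulVec x j

/-- `A` is semipositive with respect to `K₁` and `K₂` and has a left inverse mapping `K₂`
into `K₁`. -/
def MinSemiposCone {n m : ℕ} (K₁ : Set (Fin n → ℝ)) (K₂ : Set (Fin m → ℝ))
    (A : Matrix (Fin m) (Fin n) ℝ) : Prop :=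
  SemiposCone K₁ K₂ A ∧ ∃ B : Matrix (Fin n) (Fin m) ℝ,
    B * A = 1 ∧ ∀ x ∈ K₂, B.mulVec x ∈ K₁

theorem mem_interior_posOrth {m : ℕ} {x : Fin m → ℝ} :
    x ∈ interior (posOrth m) ↔ ∀ i, 0 < x i := by
  have h : posOrth m = Set.pi univ fun _ => Ici (0 : ℝ) := by
    ext y
    simp [posOrth, Pi.le_def]
  rw [h, interior_pi_set finite_univ]
  simp

theorem mulVec_mem_interior {k l : ℕ} {M : Matrix (Fin k) (Fin l) ℝ}
    (hM : Function.Surjective M.mulVec) {S : Set (Fin l → ℝ)} {T : Set (Fin k → ℝ)}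
    (h : ∀ x ∈ S, M.mulVec x ∈ T) {x : Fin l → ℝ} (hx : x ∈ interior S) :
    M.mulVec x ∈ interior T := by
  have ho : IsOpenMap M.mulVecLin := M.mulVecLin.isOpenMap_of_finiteDimensional hM
  have hsub : M.mulVecLin '' interior S ⊆ interior T := by
    refine interior_maximal ?_ (ho _ isOpen_interior)
    rintro _ ⟨y, hy, rfl⟩
    exact h y (interior_subset hy)
  exact hsub ⟨x, hx, rfl⟩

theorem surjective_mulVec_of_isUnit_det {k : ℕ} {M : Matrix (Fin k) (Fin k) ℝ}
    (hM : IsUnit M.det) : Function.Surjective M.mulVec :=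
  Matrix.mulVec_surjective_iff_isUnit.2 ((Matrix.isUnit_iff_isUnit_det M).2 hM)

theorem eventually_smul_add_mem {n : ℕ} {K : Set (Fin n → ℝ)}
    (hK : ∀ c : ℝ, 0 ≤ c → ∀ x ∈ K, c • x ∈ K) {x : Fin n → ℝ} (hx : x ∈ interior K) (y : Fin n → ℝ) :
    ∀ᶠ t : ℝ in Filter.atTop, t • x + y ∈ K := by
  have h : Filter.Tendsto (fun t : ℝ => x + t⁻¹ • y) Filter.atTop (nhds x) := by
    simpa using (tendsto_const_nhds (x := x)).add
      ((tendsto_inv_atTop_zero (𝕜 := ℝ)).smul_const y)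
  filter_upwards [h.eventually (mem_interior_iff_mem_nhds.1 hx), Filter.eventually_gt_atTop 0]
    with t ht ht0
  have := hK t ht0.le _ ht
  rwa [smul_add, smul_inv_smul₀ ht0.ne'] at this

theorem IsProperCone.zero_mem {n : ℕ} {K : Set (Fin n → ℝ)} (hK : IsProperCone K) :
    (0 : Fin n → ℝ) ∈ K := by
  have h : (0 : Fin n → ℝ) ∈ K ∩ -K := by
    rw [hK.2.2.2.1]
    rfl
  exact h.1

theorem IsProperCone.eq_zero {n : ℕ} {K : Set (Fin n → ℝ)} (hK : IsProperCone K)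
    {x : Fin n → ℝ} (hx : x ∈ K) (hx' : -x ∈ K) : x = 0 := by
  have h : x ∈ K ∩ -K := ⟨hx, hx'⟩
  rwa [hK.2.2.2.1] at h

theorem IsProperCone.ne_zero_of_mem_interior {n : ℕ} (hn : 0 < n) {K : Set (Fin n → ℝ)}
    (hK : IsProperCone K) {x : Fin n → ℝ} (hx : x ∈ interior K) : x ≠ 0 := by
  rintro rfl
  obtain ⟨t, ht⟩ := (eventually_smul_add_mem hK.2.1 hx 1).exists
  obtain ⟨s, hs⟩ := (eventually_smul_add_mem hK.2.1 hx (-1)).exists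
  rw [smul_zero, zero_add] at ht hs
  exact one_ne_zero (congrFun (hK.eq_zero ht hs) ⟨0, hn⟩)

theorem IsProperCone.mulVec_posOrth_mem {n m : ℕ} {K : Set (Fin n → ℝ)} (hK : IsProperCone K)
    {B : Matrix (Fin n) (Fin m) ℝ} (hB : ∀ j, B.col j ∈ K) {y : Fin m → ℝ}
    (hy : y ∈ posOrth m) : B.mulVec y ∈ K := by
  have hsum : B.mulVec y = ∑ j, y j • B.col j := by
    ext i
    simp [Matrix.mulVec, dotProduct, Finset.sum_apply, mul_comm]
  rw [hsum]
  exact Finset.sum_induction _ (· ∈ K) (fun a b ha hb => hK.1 a ha b hb) hK.zero_mem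
    fun j _ => hK.2.1 _ (hy j) _ (hB j)

/-- Injective matrices with range in a hyperplane and a prescribed value. -/
theorem exists_leftInverse_vecMul_eq_zero {n m : ℕ} (hnm : n < m) {x : Fin n → ℝ} (hx : x ≠ 0)
    {p ζ v : Fin m → ℝ} (hp : p ≠ 0) (hζp : ζ ⬝ᵥ p = 0) (hζv : ζ ⬝ᵥ v = 0 → v = 0) :
    ∃ (A : Matrix (Fin m) (Fin n) ℝ) (M : Matrix (Fin n) (Fin m) ℝ),
      M * A = 1 ∧ A.mulVec x = p ∧ ζ ᵥ* A = 0 ∧ M.mulVec v = 0 := by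
  let φ : (Fin m → ℝ) →ₗ[ℝ] ℝ := dotProductBilin ℝ ℝ ζ
  have hrank : Module.finrank ℝ (Fin n → ℝ) ≤ Module.finrank ℝ (LinearMap.ker φ) := by
    have h1 := φ.finrank_range_add_finrank_ker
    have h2 := Submodule.finrank_le (LinearMap.range φ)
    simp only [Module.finrank_fin_fun, Module.finrank_self] at h1 h2 ⊢
    omega
  obtain ⟨f, hf⟩ := finrank_le_iff_exists_linearMap.1 hrank
  obtain ⟨e, he⟩ := SeparatingDual.exists_continuousLinearEquiv_apply_eq (R := ℝ)
    (x := f x) (y := (⟨p, hζp⟩ : LinearMap.ker φ))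
    (fun h => hx (hf (h.trans (map_zero f).symm))) (fun h => hp (congrArg Subtype.val h))
  let g : (Fin n → ℝ) →ₗ[ℝ] (Fin m → ℝ) :=
    (LinearMap.ker φ).subtype ∘ₗ e.toLinearEquiv.toLinearMap ∘ₗ f
  have hg : Function.Injective g := Subtype.val_injective.comp (e.injective.comp hf)
  obtain ⟨l, hl⟩ := g.exists_leftInverse_of_injective (LinearMap.ker_eq_bot.2 hg)
  have hA : ζ ᵥ* LinearMap.toMatrix' g = 0 := by
    refine dotProduct_eq_zero _ fun u => ?_
    rw [← Matrix.dotProduct_mulVec, LinearMap.toMatrix'_mulVec]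
    exact (e (f u)).2
  have hlg : LinearMap.toMatrix' l * LinearMap.toMatrix' g = 1 := by
    rw [← LinearMap.toMatrix'_comp, hl, LinearMap.toMatrix'_id]
  refine ⟨LinearMap.toMatrix' g,
    LinearMap.toMatrix' l * (1 - vecMulVec ((ζ ⬝ᵥ v)⁻¹ • v) ζ), ?_, ?_, hA, ?_⟩
  · have h0 : vecMulVec ((ζ ⬝ᵥ v)⁻¹ • v) (0 : Fin n → ℝ) = 0 := by
      ext
      simp [vecMulVec_apply]
    rw [Matrix.mul_assoc, Matrix.sub_mul, Matrix.vecMulVec_mul, hA, h0, Matrix.one_mul, sub_zero,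
      hlg]
  · rw [LinearMap.toMatrix'_mulVec]
    exact congrArg Subtype.val he
  · rw [← Matrix.mulVec_mulVec, Matrix.sub_mulVec, Matrix.vecMulVec_mulVec]
    by_cases h : ζ ⬝ᵥ v = 0
    · simp [hζv h]
    · simp [smul_smul, h]

theorem mem_of_forall_pos_add_smul_mem {n : ℕ} {K : Set (Fin n → ℝ)} (hK : IsClosed K)
    {x z : Fin n → ℝ} (h : ∀ ε : ℝ, 0 < ε → x + ε • z ∈ K) : x ∈ K := by
  have hlim : Filter.Tendsto (fun t : ℝ => x + t⁻¹ • z) Filter.atTop (nhds x) := by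
    simpa using (tendsto_const_nhds (x := x)).add
      ((tendsto_inv_atTop_zero (𝕜 := ℝ)).smul_const z)
  refine hK.mem_of_tendsto hlim ?_
  filter_upwards [Filter.eventually_gt_atTop 0] with t ht
  exact h _ (inv_pos.2 ht)

theorem isClosed_posOrth (m : ℕ) : IsClosed (posOrth m) := by
  simp only [posOrth, ofPred_forall]
  exact isClosed_iInter fun i => isClosed_le continuous_const (continuous_apply i)

theorem smul_mem_posOrth {m : ℕ} (c : ℝ) (hc : 0 ≤ c) (x : Fin m → ℝ) (hx : x ∈ posOrth m) :
    c • x ∈ posOrth m :=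
  fun i => mul_nonneg hc (hx i)

/-- A matrix with a left inverse mapping the orthant into `K`, which sends `x` to a positive
multiple of `p` and whose range is orthogonal to `ζ`. The left inverse may be chosen to
annihilate `v`. -/
theorem IsProperCone.exists_leftInverse_mapsTo {n m : ℕ} (hnm : n < m) {K : Set (Fin n → ℝ)}
    (hK : IsProperCone K) {x : Fin n → ℝ} (hx : x ∈ interior K) (hx0 : x ≠ 0)
    {p β ζ v : Fin m → ℝ} (hp : ∀ i, 0 < p i) (hβ : ∀ i, 0 < β i) (hζp : ζ ⬝ᵥ p = 0)
    (hβv : β ⬝ᵥ v = 0) (hζv : ζ ⬝ᵥ v = 0 → v = 0) :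
    ∃ (A : Matrix (Fin m) (Fin n) ℝ) (B : Matrix (Fin n) (Fin m) ℝ) (c : ℝ),
      B * A = 1 ∧ (∀ y ∈ posOrth m, B.mulVec y ∈ K) ∧ 0 < c ∧ A.mulVec x = c • p ∧
        ζ ᵥ* A = 0 ∧ B.mulVec v = 0 := by
  have hm : 0 < m := by omega
  obtain ⟨A₀, M, hMA, hAx, hζA, hMv⟩ := exists_leftInverse_vecMul_eq_zero hnm hx0
    (fun h => (hp ⟨0, hm⟩).ne' (congrFun h _)) hζp hζv
  have hev : ∀ᶠ t : ℝ in Filter.atTop, ∀ j, t • x + (β j)⁻¹ • M.col j ∈ K :=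
    Filter.eventually_all.2 fun j => eventually_smul_add_mem hK.2.1 hx _
  obtain ⟨t, ht, ht0⟩ := (hev.and (Filter.eventually_gt_atTop 0)).exists
  set B := M + t • vecMulVec x β with hB
  have hBK : ∀ y ∈ posOrth m, B.mulVec y ∈ K := by
    intro y hy
    refine hK.mulVec_posOrth_mem (fun j => ?_) hy
    convert hK.2.1 (β j) (hβ j).le _ (ht j) using 1
    ext i
    have := (hβ j).ne'
    simp [hB, vecMulVec_apply]
    field_simp
    ring
  have hs : 0 < β ⬝ᵥ p :=
    Finset.sum_pos (fun i _ => mul_pos (hβ i) (hp i)) ⟨⟨0, hm⟩, Finset.mem_univ _⟩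
  have hBA : ∀ u, (B * A₀).mulVec u = u + (t * (β ⬝ᵥ A₀.mulVec u)) • x := by
    intro u
    rw [hB, Matrix.add_mul, hMA, Matrix.add_mulVec, Matrix.one_mulVec, ← Matrix.mulVec_mulVec,
      Matrix.smul_mulVec, Matrix.vecMulVec_mulVec]
    simp [smul_smul]
  have hunit : IsUnit (B * A₀).det := by
    rw [← Matrix.isUnit_iff_isUnit_det, ← Matrix.mulVec_injective_iff_isUnit]
    refine (injective_iff_map_eq_zero (B * A₀).mulVecLin).2 fun u hu => ?_
    have hu' : u + (t * (β ⬝ᵥ A₀.mulVec u)) • x = 0 := (hBA u).symm.trans hu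
    have h := congrArg (fun w => β ⬝ᵥ A₀.mulVec w) hu'
    simp only [Matrix.mulVec_add, Matrix.mulVec_smul, hAx, dotProduct_add, dotProduct_smul,
      Matrix.mulVec_zero, dotProduct_zero, smul_eq_mul] at h
    have h0 : (β ⬝ᵥ A₀.mulVec u) * (1 + t * (β ⬝ᵥ p)) = 0 := by linarith
    have h1 : β ⬝ᵥ A₀.mulVec u = 0 :=
      (mul_eq_zero.1 h0).resolve_right (by positivity)
    simpa [h1] using hu'
  have hc : 0 < 1 + t * (β ⬝ᵥ p) := by positivity
  have hx' : (B * A₀).mulVec x = (1 + t * (β ⬝ᵥ p)) • x := by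
    rw [hBA, hAx, add_smul, one_smul]
  have hinv : (B * A₀)⁻¹.mulVec x = (1 + t * (β ⬝ᵥ p))⁻¹ • x := by
    have h := congrArg (B * A₀)⁻¹.mulVec hx'
    rw [Matrix.mulVec_mulVec, Matrix.nonsing_inv_mul _ hunit, Matrix.one_mulVec,
      Matrix.mulVec_smul] at h
    rw [eq_inv_smul_iff₀ hc.ne', ← h]
  refine ⟨A₀ * (B * A₀)⁻¹, B, (1 + t * (β ⬝ᵥ p))⁻¹, ?_, hBK, inv_pos.2 hc, ?_, ?_, ?_⟩
  · rw [← Matrix.mul_assoc, Matrix.mul_nonsing_inv _ hunit]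
  · rw [← Matrix.mulVec_mulVec, hinv, Matrix.mulVec_smul, hAx]
  · rw [← Matrix.vecMul_vecMul, hζA, Matrix.zero_vecMul]
  · rw [hB, Matrix.add_mulVec, hMv, Matrix.smul_mulVec, Matrix.vecMulVec_mulVec, hβv]
    simp

theorem minSemiposCone_of_mulVec_eq_smul {n m : ℕ} {K : Set (Fin n → ℝ)} {x : Fin n → ℝ}
    (hx : x ∈ interior K) {p : Fin m → ℝ} (hp : ∀ i, 0 < p i) {c : ℝ} (hc : 0 < c)
    {A : Matrix (Fin m) (Fin n) ℝ} {B : Matrix (Fin n) (Fin m) ℝ} (hBA : B * A = 1)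
    (hB : ∀ y ∈ posOrth m, B.mulVec y ∈ K) (hA : A.mulVec x = c • p) :
    MinSemiposCone K (posOrth m) A := by
  refine ⟨⟨x, hx, ?_⟩, B, hBA, hB⟩
  rw [hA, mem_interior_posOrth]
  exact fun i => mul_pos hc (hp i)

section Preserver

variable {n m : ℕ} {K : Set (Fin n → ℝ)} {X : Matrix (Fin m) (Fin m) ℝ}
  {Y : Matrix (Fin n) (Fin n) ℝ}

theorem dotProduct_mulVec_ne_zero_of_preserver (hn : 0 < n) (hnm : n < m) (hK : IsProperCone K)
    (hL : ∀ A, MinSemiposCone K (posOrth m) A → MinSemiposCone K (posOrth m) (X * A * Y))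
    {w p : Fin m → ℝ} (hw : ∀ i, 0 ≤ w i) (hw0 : w ≠ 0) (hp : ∀ i, 0 < p i) :
    w ⬝ᵥ X.mulVec p ≠ 0 := by
  intro h
  obtain ⟨x, hx⟩ := hK.2.2.2.2
  rw [Matrix.dotProduct_mulVec] at h
  obtain ⟨A, B, c, hBA, hB, hc, hA, hζ, -⟩ := hK.exists_leftInverse_mapsTo hnm hx
    (hK.ne_zero_of_mem_interior hn hx) (β := 1) (v := 0) hp (fun _ => one_pos) h (by simp)
    (by simp)
  obtain ⟨⟨y, -, hy⟩, -⟩ := hL A (minSemiposCone_of_mulVec_eq_smul hx hp hc hBA hB hA)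
  rw [mem_interior_posOrth] at hy
  obtain ⟨i, hi⟩ := Function.ne_iff.1 hw0
  have hpos : 0 < w ⬝ᵥ (X * A * Y).mulVec y :=
    Finset.sum_pos' (fun j _ => mul_nonneg (hw j) (hy j).le)
      ⟨i, Finset.mem_univ _, mul_pos (lt_of_le_of_ne (hw i) (Ne.symm hi)) (hy i)⟩
  rw [Matrix.dotProduct_mulVec, ← Matrix.vecMul_vecMul, ← Matrix.vecMul_vecMul, hζ] at hpos
  simp at hpos

theorem mulVec_pos_or_neg_of_preserver (hn : 0 < n) (hnm : n < m) (hK : IsProperCone K)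
    (hL : ∀ A, MinSemiposCone K (posOrth m) A → MinSemiposCone K (posOrth m) (X * A * Y)) :
    (∀ p : Fin m → ℝ, (∀ i, 0 < p i) → ∀ i, 0 < X.mulVec p i) ∨
      (∀ p : Fin m → ℝ, (∀ i, 0 < p i) → ∀ i, 0 < (-X).mulVec p i) := by
  by_contra! hcon
  obtain ⟨⟨p, hp, i, hi⟩, q, hq, j, hj⟩ := hcon
  rw [Matrix.neg_mulVec, Pi.neg_apply, neg_nonpos] at hj
  have hconv : Convex ℝ (Set.pi univ fun _ : Fin m => Ioi (0 : ℝ)) :=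
    convex_pi fun _ _ => convex_Ioi 0
  have hpre := (convex_stdSimplex ℝ (Fin m)).isPreconnected.prod hconv.isPreconnected
  have hcont : Continuous fun a : (Fin m → ℝ) × (Fin m → ℝ) => a.1 ⬝ᵥ X.mulVec a.2 := by
    fun_prop
  obtain ⟨a, ha, ha0⟩ := hpre.intermediate_value
    (a := (Pi.single i 1, p)) (b := (Pi.single j 1, q))
    ⟨single_mem_stdSimplex ℝ i, fun k _ => hp k⟩ ⟨single_mem_stdSimplex ℝ j, fun k _ => hq k⟩
    hcont.continuousOn (show (0 : ℝ) ∈ Icc _ _ by simpa using ⟨hi, hj⟩)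
  refine dotProduct_mulVec_ne_zero_of_preserver hn hnm hK hL ha.1.1 ?_
    (fun k => ha.2 k trivial) ha0
  intro h
  simpa [h] using ha.1.2

theorem inv_mulVec_mem_of_preserver (hn : 0 < n) (hnm : n < m) (hK : IsProperCone K)
    (hL : ∀ A, MinSemiposCone K (posOrth m) A → MinSemiposCone K (posOrth m) (X * A * Y))
    (hX : ∀ p : Fin m → ℝ, (∀ i, 0 < p i) → ∀ i, 0 < X.mulVec p i) :
    IsUnit Y.det ∧ ∀ x ∈ K, Y⁻¹.mulVec x ∈ K := by
  have key : ∀ x ∈ interior K, IsUnit Y.det ∧ Y⁻¹.mulVec x ∈ K := by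
    intro x hx
    obtain ⟨A, B, c, hBA, hB, hc, hA, -, -⟩ := hK.exists_leftInverse_mapsTo hnm hx
      (hK.ne_zero_of_mem_interior hn hx) (p := 1) (β := 1) (ζ := 0) (v := 0)
      (fun _ => one_pos) (fun _ => one_pos) (by simp) (by simp) (by simp)
    obtain ⟨-, C, hC, hCK⟩ := hL A
      (minSemiposCone_of_mulVec_eq_smul hx (fun _ => one_pos) hc hBA hB hA)
    have hCY : C * X * A * Y = 1 := by simpa only [Matrix.mul_assoc] using hC
    refine ⟨Matrix.isUnit_det_of_left_inverse hCY, ?_⟩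
    rw [Matrix.inv_eq_left_inv hCY, ← Matrix.mulVec_mulVec, hA, ← Matrix.mulVec_mulVec]
    exact hCK _ fun i => (hX _ (fun j => mul_pos hc one_pos) i).le
  obtain ⟨z, hz⟩ := hK.2.2.2.2
  refine ⟨(key z hz).1, fun x hx => ?_⟩
  refine mem_of_forall_pos_add_smul_mem hK.2.2.1 (z := Y⁻¹.mulVec z) fun ε hε => ?_
  rw [← Matrix.mulVec_smul, ← Matrix.mulVec_add]
  refine (key _ ?_).2
  have ho : IsOpenMap fun y : Fin n → ℝ => x + ε • y :=
    (isOpenMap_add_left x).comp (isOpenMap_smul₀ hε.ne')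
  refine interior_maximal ?_ (ho _ isOpen_interior) ⟨z, hz, rfl⟩
  rintro _ ⟨y, hy, rfl⟩
  exact hK.1 _ hx _ (hK.2.1 _ hε.le _ (interior_subset hy))

theorem exists_pos_dotProduct_eq_zero {m : ℕ} {v : Fin m → ℝ} {i j : Fin m} (hi : v i < 0)
    (hj : 0 < v j) : ∃ β : Fin m → ℝ, (∀ k, 0 < β k) ∧ β ⬝ᵥ v = 0 := by
  rcases le_total 0 (1 ⬝ᵥ v) with h | h
  · refine ⟨1 + Pi.single i ((1 ⬝ᵥ v) / -v i), fun k => ?_, ?_⟩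
    · have : 0 ≤ (Pi.single i ((1 ⬝ᵥ v) / -v i) : Fin m → ℝ) :=
        Pi.single_nonneg.2 (div_nonneg h (by linarith))
      have := this k
      simp only [Pi.add_apply, Pi.one_apply, Pi.zero_apply] at this ⊢
      linarith
    · rw [add_dotProduct, single_dotProduct]
      have := hi.ne
      field_simp
      ring
  · refine ⟨1 + Pi.single j (-(1 ⬝ᵥ v) / v j), fun k => ?_, ?_⟩
    · have : 0 ≤ (Pi.single j (-(1 ⬝ᵥ v) / v j) : Fin m → ℝ) :=
        Pi.single_nonneg.2 (div_nonneg (by linarith) hj.le)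
      have := this k
      simp only [Pi.add_apply, Pi.one_apply, Pi.zero_apply] at this ⊢
      linarith
    · rw [add_dotProduct, single_dotProduct]
      have := hj.ne'
      field_simp
      ring

theorem exists_dotProduct_eq_zero_and_eq_one {n : ℕ} (hn : 2 ≤ n) (x : Fin n → ℝ) :
    ∃ φ u : Fin n → ℝ, φ ⬝ᵥ x = 0 ∧ φ ⬝ᵥ u = 1 := by
  let a : Fin n := ⟨0, by omega⟩
  let b : Fin n := ⟨1, by omega⟩
  have hab : a ≠ b := by simp [a, b]
  by_cases h : x a = 0
  · exact ⟨Pi.single a 1, Pi.single a 1, by simp [h], by simp⟩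
  · refine ⟨Pi.single b 1 - Pi.single a (x b / x a), Pi.single b 1, ?_, ?_⟩
    · simp [sub_dotProduct, h]
    · simp [hab.symm]

theorem nonneg_of_mulVec_pos_of_preserver (hn : 2 ≤ n) (hnm : n < m) (hK : IsProperCone K)
    (hL : ∀ A, MinSemiposCone K (posOrth m) A → MinSemiposCone K (posOrth m) (X * A * Y))
    (hX : ∀ p : Fin m → ℝ, (∀ i, 0 < p i) → ∀ i, 0 < X.mulVec p i)
    {v : Fin m → ℝ} (hv : ∀ i, 0 < X.mulVec v i) : v ∈ posOrth m := by
  by_contra hcon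
  obtain ⟨i, hi⟩ : ∃ i, v i < 0 := by
    by_contra! h
    exact hcon h
  obtain ⟨j, hj⟩ : ∃ j, 0 < v j := by
    by_contra! h
    have hmem : X.mulVec (-v) ∈ posOrth m := by
      refine mem_of_forall_pos_add_smul_mem (isClosed_posOrth m) (z := X.mulVec 1)
        fun ε hε => ?_
      rw [← Matrix.mulVec_smul, ← Matrix.mulVec_add]
      refine fun k => (hX _ (fun l => ?_) k).le
      have := h l
      simp only [Pi.add_apply, Pi.neg_apply, Pi.smul_apply, Pi.one_apply, smul_eq_mul]
      linarith
    have h1 := hmem i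
    rw [Matrix.mulVec_neg, Pi.neg_apply] at h1
    linarith [hv i]
  obtain ⟨β, hβ, hβv⟩ := exists_pos_dotProduct_eq_zero hi hj
  obtain ⟨x, hx⟩ := hK.2.2.2.2
  have hx0 := hK.ne_zero_of_mem_interior (by omega) hx
  obtain ⟨hY, hYK⟩ := inv_mulVec_mem_of_preserver (by omega) hnm hK hL hX
  have hp : ∀ i, 0 < (1 : Fin m → ℝ) i := fun _ => one_pos
  obtain ⟨A, B, c, hBA, hB, hc, hA, -, hBv⟩ := hK.exists_leftInverse_mapsTo hnm hx hx0
    (p := 1) (ζ := Pi.single i 1 - Pi.single j 1) hp hβ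
    (by simp [sub_dotProduct]) hβv (by
      simp only [sub_dotProduct, single_dotProduct, one_mul]
      intro h
      linarith)
  obtain ⟨φ, u, hφx, hφu⟩ := exists_dotProduct_eq_zero_and_eq_one hn x
  have hmem : ∀ s : ℝ, Y⁻¹.mulVec u - s • Y⁻¹.mulVec x ∈ K := by
    intro s
    obtain ⟨t, ht⟩ := (eventually_smul_add_mem smul_mem_posOrth (mem_interior_posOrth.2 hv)
      (X.mulVec (A.mulVec u) - s • X.mulVec (c • 1))).exists
    have hAt : ∀ y, (A + t • vecMulVec v φ).mulVec y =
        A.mulVec y + (t * (φ ⬝ᵥ y)) • v := by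
      intro y
      rw [Matrix.add_mulVec, Matrix.smul_mulVec, Matrix.vecMulVec_mulVec]
      simp [smul_smul]
    obtain ⟨-, C, hC, hCK⟩ := hL (A + t • vecMulVec v φ)
      (minSemiposCone_of_mulVec_eq_smul hx hp hc (B := B)
        (by rw [Matrix.mul_add, hBA, Matrix.mul_smul, Matrix.mul_vecMulVec, hBv,
          Matrix.zero_vecMulVec, smul_zero, add_zero])
        hB (by rw [hAt, hφx, hA]; simp))
    have hCY : C * X * (A + t • vecMulVec v φ) * Y = 1 := by
      simpa only [Matrix.mul_assoc] using hC
    have hinv : ∀ y, Y⁻¹.mulVec y =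
        C.mulVec (X.mulVec (A.mulVec y + (t * (φ ⬝ᵥ y)) • v)) := by
      intro y
      rw [Matrix.inv_eq_left_inv hCY, ← Matrix.mulVec_mulVec, hAt, ← Matrix.mulVec_mulVec]
    have h := hCK _ ht
    convert h using 1
    rw [hinv, hinv, hφx, hφu, hA, ← Matrix.mulVec_smul, ← Matrix.mulVec_sub]
    simp only [Matrix.mulVec_add, Matrix.mulVec_sub, Matrix.mulVec_smul, mul_zero, zero_smul,
      add_zero, mul_one]
    abel
  have hneg : -Y⁻¹.mulVec x ∈ K := by
    refine mem_of_forall_pos_add_smul_mem hK.2.2.1 (z := Y⁻¹.mulVec u) fun ε hε => ?_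
    convert hK.2.1 ε hε.le _ (hmem ε⁻¹) using 1
    rw [smul_sub, smul_inv_smul₀ hε.ne']
    abel
  have hzero := hK.eq_zero (hYK x (interior_subset hx)) hneg
  apply hx0
  rw [← Matrix.one_mulVec x, ← Matrix.mul_nonsing_inv _ hY, ← Matrix.mulVec_mulVec, hzero,
    Matrix.mulVec_zero]

theorem image_posOrth_eq_of_preserver (hn : 2 ≤ n) (hnm : n < m) (hK : IsProperCone K)
    (hL : ∀ A, MinSemiposCone K (posOrth m) A → MinSemiposCone K (posOrth m) (X * A * Y))
    (hX : ∀ p : Fin m → ℝ, (∀ i, 0 < p i) → ∀ i, 0 < X.mulVec p i) :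
    X.mulVec '' posOrth m = posOrth m := by
  have hX1 : ∀ i, 0 < X.mulVec 1 i := hX 1 fun _ => one_pos
  have hrefl : ∀ v, X.mulVec v ∈ posOrth m → v ∈ posOrth m := by
    intro v hv
    refine mem_of_forall_pos_add_smul_mem (isClosed_posOrth m) (z := 1) fun ε hε => ?_
    refine nonneg_of_mulVec_pos_of_preserver hn hnm hK hL hX fun i => ?_
    rw [Matrix.mulVec_add, Matrix.mulVec_smul]
    exact add_pos_of_nonneg_of_pos (hv i) (mul_pos hε (hX1 i))
  have hsurj : Function.Surjective X.mulVec := by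
    rw [Matrix.mulVec_surjective_iff_isUnit, ← Matrix.mulVec_injective_iff_isUnit]
    refine (injective_iff_map_eq_zero X.mulVecLin).2 fun v hv => ?_
    have hv' : X.mulVec v = 0 := hv
    have h1 := hrefl v (by simp [hv', posOrth])
    have h2 := hrefl (-v) (by simp [Matrix.mulVec_neg, hv', posOrth])
    ext i
    have := h1 i
    have := h2 i
    simp only [Pi.neg_apply, Pi.zero_apply] at *
    linarith
  refine Subset.antisymm ?_ fun y hy => ?_
  · rintro _ ⟨p, hp, rfl⟩
    refine mem_of_forall_pos_add_smul_mem (isClosed_posOrth m) (z := X.mulVec 1)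
      fun ε hε => ?_
    rw [← Matrix.mulVec_smul, ← Matrix.mulVec_add]
    exact fun i => (hX _ (fun k => add_pos_of_nonneg_of_pos (hp k) (mul_pos hε one_pos)) i).le
  · obtain ⟨v, rfl⟩ := hsurj y
    exact ⟨v, hrefl v hy, rfl⟩

theorem preserver_posOrth (hn : 2 ≤ n) (hnm : n < m) (hK : IsProperCone K)
    (hL : ∀ A, MinSemiposCone K (posOrth m) A → MinSemiposCone K (posOrth m) (X * A * Y)) :
    (X.mulVec '' posOrth m = posOrth m ∧ IsUnit Y.det ∧ ∀ x ∈ K, Y⁻¹.mulVec x ∈ K) ∨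
      ((-X).mulVec '' posOrth m = posOrth m ∧ IsUnit (-Y).det ∧
        ∀ x ∈ K, (-Y)⁻¹.mulVec x ∈ K) := by
  rcases mulVec_pos_or_neg_of_preserver (by omega) hnm hK hL with hX | hX
  · exact Or.inl ⟨image_posOrth_eq_of_preserver hn hnm hK hL hX,
      inv_mulVec_mem_of_preserver (by omega) hnm hK hL hX⟩
  · have hL' : ∀ A, MinSemiposCone K (posOrth m) A →
        MinSemiposCone K (posOrth m) (-X * A * -Y) := by
      simpa using hL
    exact Or.inr ⟨image_posOrth_eq_of_preserver hn hnm hK hL' hX,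
      inv_mulVec_mem_of_preserver (by omega) hnm hK hL' hX⟩

theorem MinSemiposCone.mul_mul {K₂ : Set (Fin m → ℝ)} (hK₂ : IsProperCone K₂)
    (hX : X.mulVec '' K₂ = K₂) (hY : IsUnit Y.det) (hYK : ∀ x ∈ K, Y⁻¹.mulVec x ∈ K)
    {A : Matrix (Fin m) (Fin n) ℝ} (hA : MinSemiposCone K K₂ A) :
    MinSemiposCone K K₂ (X * A * Y) := by
  have hsurj : Function.Surjective X.mulVec := by
    refine (LinearMap.range_eq_top (f := X.mulVecLin)).1
      (Submodule.eq_top_of_nonempty_interior' _ (hK₂.2.2.2.2.mono (interior_mono ?_)))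
    rw [← hX]
    rintro _ ⟨y, -, rfl⟩
    exact ⟨y, rfl⟩
  have hXdet : IsUnit X.det :=
    (Matrix.isUnit_iff_isUnit_det X).1 (Matrix.mulVec_surjective_iff_isUnit.1 hsurj)
  obtain ⟨⟨x, hx, hAx⟩, B, hBA, hB⟩ := hA
  refine ⟨⟨Y⁻¹.mulVec x, ?_, ?_⟩, Y⁻¹ * B * X⁻¹, ?_, fun y hy => ?_⟩
  · exact mulVec_mem_interior
      (surjective_mulVec_of_isUnit_det (Matrix.isUnit_nonsing_inv_det _ hY)) hYK hx
  · rw [Matrix.mulVec_mulVec, Matrix.mul_nonsing_inv_cancel_right _ _ hY, ← Matrix.mulVec_mulVec]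
    exact mulVec_mem_interior hsurj (fun y hy => hX ▸ mem_image_of_mem _ hy) hAx
  · calc Y⁻¹ * B * X⁻¹ * (X * A * Y) = Y⁻¹ * (B * (X⁻¹ * X * A)) * Y := by
          simp only [Matrix.mul_assoc]
      _ = 1 := by
          rw [Matrix.nonsing_inv_mul _ hXdet, Matrix.one_mul, hBA, Matrix.mul_one,
            Matrix.nonsing_inv_mul _ hY]
  · rw [← hX] at hy
    obtain ⟨z, hz, rfl⟩ := hy
    rw [Matrix.mulVec_mulVec, Matrix.nonsing_inv_mul_cancel_right _ _ hXdet,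
      ← Matrix.mulVec_mulVec]
    exact hYK _ (hB z hz)

end Preserver

theorem MinSemiposCone.mul_left {n m : ℕ} {K₁ : Set (Fin n → ℝ)} {K₂ K₃ : Set (Fin m → ℝ)}
    {W : Matrix (Fin m) (Fin m) ℝ} (hW : IsUnit W.det) (h : W.mulVec '' K₂ = K₃)
    {A : Matrix (Fin m) (Fin n) ℝ} (hA : MinSemiposCone K₁ K₂ A) :
    MinSemiposCone K₁ K₃ (W * A) := by
  obtain ⟨⟨x, hx, hAx⟩, B, hBA, hB⟩ := hA
  refine ⟨⟨x, hx, ?_⟩, B * W⁻¹, ?_, fun y hy => ?_⟩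
  · rw [← Matrix.mulVec_mulVec]
    exact mulVec_mem_interior (surjective_mulVec_of_isUnit_det hW)
      (fun y hy => h ▸ mem_image_of_mem _ hy) hAx
  · rw [Matrix.mul_assoc, Matrix.nonsing_inv_mul_cancel_left _ _ hW, hBA]
  · rw [← h] at hy
    obtain ⟨z, hz, rfl⟩ := hy
    rw [Matrix.mulVec_mulVec, Matrix.nonsing_inv_mul_cancel_right _ _ hW]
    exact hB z hz

theorem image_mulVec_eq_of_conj {m : ℕ} {W X : Matrix (Fin m) (Fin m) ℝ} (hW : IsUnit W.det)
    {K : Set (Fin m → ℝ)} (h : (W⁻¹ * X * W).mulVec '' K = K) :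
    X.mulVec '' (W.mulVec '' K) = W.mulVec '' K := by
  conv_rhs => rw [← h]
  simp only [image_image, Matrix.mulVec_mulVec, Matrix.mul_assoc,
    Matrix.mul_nonsing_inv_cancel_left _ _ hW]

theorem stmt_17 {n m : ℕ} (hn : 2 ≤ n) (hnm : n < m)
    (K₁ : Set (Fin n → ℝ)) (K₂ : Set (Fin m → ℝ))
    (hK₁ : IsProperCone K₁) (hK₂ : IsProperCone K₂)
    (hsimp : ∃ W : Matrix (Fin m) (Fin m) ℝ, IsUnit W.det ∧
      W.mulVec '' posOrth m = K₂)
    (X : Matrix (Fin m) (Fin m) ℝ) (Y : Matrix (Fin n) (Fin n) ℝ) :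
    (∀ A : Matrix (Fin m) (Fin n) ℝ,
        (SemiposCone K₁ K₂ A ∧ ∃ B : Matrix (Fin n) (Fin m) ℝ,
          B * A = 1 ∧ ∀ x ∈ K₂, B.mulVec x ∈ K₁) →
        (SemiposCone K₁ K₂ (X * A * Y) ∧ ∃ B : Matrix (Fin n) (Fin m) ℝ,
          B * (X * A * Y) = 1 ∧ ∀ x ∈ K₂, B.mulVec x ∈ K₁)) ↔
      ((X.mulVec '' K₂ = K₂ ∧ IsUnit Y.det ∧ ∀ x ∈ K₁, Y⁻¹.mulVec x ∈ K₁) ∨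
        ((-X).mulVec '' K₂ = K₂ ∧ IsUnit (-Y).det ∧
          ∀ x ∈ K₁, (-Y)⁻¹.mulVec x ∈ K₁)) := by
  obtain ⟨W, hW, rfl⟩ := hsimp
  constructor
  · intro hL
    have hW' : IsUnit W⁻¹.det := Matrix.isUnit_nonsing_inv_det _ hW
    have himg : W⁻¹.mulVec '' (W.mulVec '' posOrth m) = posOrth m := by
      simp [image_image, Matrix.mulVec_mulVec, Matrix.nonsing_inv_mul _ hW]
    have hconj : ∀ A, MinSemiposCone K₁ (posOrth m) A →
        MinSemiposCone K₁ (posOrth m) (W⁻¹ * X * W * A * Y) := by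
      intro A hA
      have h := MinSemiposCone.mul_left hW' himg (hL _ (hA.mul_left hW rfl))
      simpa only [Matrix.mul_assoc] using h
    refine (preserver_posOrth hn hnm hK₁ hconj).imp
      (fun h => ⟨image_mulVec_eq_of_conj hW h.1, h.2⟩)
      (fun h => ⟨image_mulVec_eq_of_conj hW ?_, h.2⟩)
    simpa using h.1
  · rintro (⟨hX, hY, hYK⟩ | ⟨hX, hY, hYK⟩) A hA
    · exact MinSemiposCone.mul_mul hK₂ hX hY hYK hA
    · have h := MinSemiposCone.mul_mul hK₂ hX hY hYK hA
      rwa [Matrix.neg_mul, Matrix.neg_mul, Matrix.mul_neg, neg_neg] at h
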